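/- arXiv:1001.1345 — 2 statements merged into one kernel-verified Lean document; each statement's English description precedes it below -/
import Mathlib

section
/- Let X_1 be a random variable that is regularly varying with index α ∈ (0,1) and tail balance parameters p and q, and let (a_n) be a positive sequence with n P(|X_1|>a_n) → 1. Then, as n→∞, n E[ (X_1/a_n) 1{|X_1| ≤ a_n} ] → (p−q) α/(1−α). -/
open MeasureTheory Filter Set

/-- A Potter-type bound: a nonincreasing function with values in `[0, 1]`, positive on the positive
half-line, that grows by a factor of at most `2 ^ β` when a large argument is halved, satisfies
`T (u * x) ≤ C * u ^ (-β) * T x` for all large `x` and all `u ∈ (0, 1]`. -/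
lemma exists_potter_bound {T : ℝ → ℝ} (hT : Antitone T) (hT1 : ∀ x, T x ≤ 1)
    (hTpos : ∀ x, 0 < x → 0 < T x) {β x₀ : ℝ} (hβ : 0 ≤ β) (hx₀ : 0 < x₀)
    (hhalf : ∀ x, x₀ ≤ x → T (x / 2) ≤ 2 ^ β * T x) :
    ∃ C : ℝ, 0 ≤ C ∧ ∀ x, x₀ ≤ x → ∀ u : ℝ, 0 < u → u ≤ 1 →
      T (u * x) ≤ C * u ^ (-β) * T x := by
  set C := max (1 / T (2 * x₀)) ((2 : ℝ) ^ β) with hC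
  have h2 : (0 : ℝ) < 2 ^ β := by positivity
  have hC0 : 0 < C := lt_max_of_lt_right h2
  have one_le_rpow : ∀ u : ℝ, 0 < u → u ≤ 1 → 1 ≤ u ^ (-β) := fun u hu hu1 =>
    Real.one_le_rpow_of_pos_of_le_one_of_nonpos hu hu1 (by linarith)
  have key : ∀ k : ℕ, ∀ x, x₀ ≤ x → x ≤ 2 ^ (k + 1) * x₀ → ∀ u : ℝ, 0 < u → u ≤ 1 →
      T (u * x) ≤ C * u ^ (-β) * T x := by
    intro k
    induction k with
    | zero =>
      intro x hx hx2 u hu hu1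
      have hT2 : 0 < T (2 * x₀) := hTpos _ (by positivity)
      have hle : T (2 * x₀) ≤ T x := hT (by simpa using hx2)
      have hone : 1 ≤ C * T x := by
        calc (1 : ℝ) = 1 / T (2 * x₀) * T (2 * x₀) := by field_simp
          _ ≤ C * T x := mul_le_mul (le_max_left _ _) hle hT2.le hC0.le
      calc T (u * x) ≤ 1 := hT1 _
        _ ≤ (C * T x) * u ^ (-β) := one_le_mul_of_one_le_of_one_le hone (one_le_rpow u hu hu1)
        _ = C * u ^ (-β) * T x := by ring
    | succ k ih =>
      intro x hx hx2 u hu hu1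
      by_cases hxk : x ≤ 2 ^ (k + 1) * x₀
      · exact ih x hx hxk u hu hu1
      have hxhalf : x₀ ≤ x / 2 := by
        have : (1 : ℝ) ≤ 2 ^ k := one_le_pow₀ (by norm_num)
        rw [not_le, pow_succ] at hxk
        nlinarith
      have hTx : 0 < T x := hTpos _ (hx₀.trans_le hx)
      rcases le_or_gt u (1 / 2) with hu2 | hu2
      · have h := ih (x / 2) hxhalf (by rw [pow_succ] at hx2; linarith) (2 * u)
          (by linarith) (by linarith)
        have h2u : (2 * u) ^ (-β) * 2 ^ β = u ^ (-β) := by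
          rw [Real.mul_rpow (by norm_num) hu.le, Real.rpow_neg (by norm_num : (0 : ℝ) ≤ 2)]
          field_simp
        calc T (u * x) = T (2 * u * (x / 2)) := by congr 1; ring
          _ ≤ C * (2 * u) ^ (-β) * T (x / 2) := h
          _ ≤ C * (2 * u) ^ (-β) * (2 ^ β * T x) := by
            gcongr
            exact hhalf x hx
          _ = C * ((2 * u) ^ (-β) * 2 ^ β) * T x := by ring
          _ = C * u ^ (-β) * T x := by rw [h2u]
      · calc T (u * x) ≤ T (x / 2) := hT (by nlinarith)
          _ ≤ 2 ^ β * T x := hhalf x hx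
          _ ≤ C * u ^ (-β) * T x := by
            gcongr
            exact (le_max_right _ _).trans
              (le_mul_of_one_le_right hC0.le (one_le_rpow u hu hu1))
  refine ⟨C, hC0.le, fun x hx u hu hu1 => ?_⟩
  obtain ⟨k, hk⟩ := pow_unbounded_of_one_lt (x / x₀) (one_lt_two (α := ℝ))
  refine key k x hx ?_ u hu hu1
  rw [div_lt_iff₀ hx₀] at hk
  rw [pow_succ]
  nlinarith [hx₀.trans_le hx]

/-- The limit of the truncated means of the positive part of a regularly varying variable. -/
lemma tendsto_truncated_mean_pos
    {Ω : Type*} [MeasurableSpace Ω] (P : Measure Ω) [IsProbabilityMeasure P]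
    (X : Ω → ℝ) (hX : Measurable X) (α p : ℝ) (hα : 0 < α) (hα1 : α < 1)
    (hpos : ∀ x : ℝ, 0 < x → 0 < P.real {ω | x < |X ω|})
    (hrv : ∀ u : ℝ, 0 < u →
      Tendsto (fun x : ℝ => P.real {ω | u * x < |X ω|} / P.real {ω | x < |X ω|})
        atTop (nhds (u ^ (-α))))
    (hbalp : Tendsto (fun x : ℝ => P.real {ω | x < X ω} / P.real {ω | x < |X ω|})
      atTop (nhds p))
    (a : ℕ → ℝ) (ha : ∀ n, 0 < a n)
    (han : Tendsto (fun n : ℕ => (n : ℝ) * P.real {ω | a n < |X ω|}) atTop (nhds 1)) :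
    Tendsto (fun n : ℕ =>
        (n : ℝ) * ∫ ω, (if 0 < X ω ∧ X ω ≤ a n then X ω / a n else 0) ∂P)
      atTop (nhds (p * (α / (1 - α)))) := by
  set T : ℝ → ℝ := fun x => P.real {ω | x < |X ω|} with hTdef
  have hT : Antitone T := fun x y hxy => measureReal_mono fun ω hω => lt_of_le_of_lt hxy hω
  -- the normalizing sequence diverges
  have hT0 : Tendsto (fun n => T (a n)) atTop (nhds 0) := by
    have h := han.mul (tendsto_inv_atTop_nhds_zero_nat (𝕜 := ℝ))
    rw [mul_zero] at h
    refine h.congr' ?_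
    filter_upwards [eventually_gt_atTop 0] with n hn
    have : (n : ℝ) ≠ 0 := by positivity
    simp only [hTdef]
    field_simp
  have hatop : Tendsto a atTop atTop := by
    refine tendsto_atTop.2 fun M => ?_
    filter_upwards [hT0.eventually_lt_const (hpos (max M 1) (by positivity))] with n hn
    by_contra! hlt
    exact absurd (hT (hlt.le.trans (le_max_left M 1))) (not_le.2 hn)
  -- domination
  obtain ⟨β, hαβ, hβ1⟩ := exists_between hα1
  have hhalf : ∀ᶠ x in atTop, T (x / 2) ≤ 2 ^ β * T x := by
    have h := hrv (1 / 2) (by norm_num)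
    have hlt : (1 / 2 : ℝ) ^ (-α) < 2 ^ β := by
      rw [Real.rpow_neg (by norm_num), ← Real.inv_rpow (by norm_num)]
      norm_num
      exact hαβ
    filter_upwards [h.eventually_lt_const hlt, eventually_gt_atTop 0] with x hx hx0
    rw [div_lt_iff₀ (hpos x hx0)] at hx
    have : x / 2 = 1 / 2 * x := by ring
    rw [this]
    exact hx.le
  obtain ⟨x₀, hx₀⟩ := eventually_atTop.1 hhalf
  obtain ⟨C, hC0, hC⟩ := exists_potter_bound hT (fun x => measureReal_le_one) hpos
    (β := β) (x₀ := max x₀ 1) (hα.trans hαβ).le (by positivity)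
    (fun x hx => hx₀ x ((le_max_left _ _).trans hx))
  set f : ℕ → Ω → ℝ := fun n ω => if 0 < X ω ∧ X ω ≤ a n then X ω / a n else 0 with hf
  have hfm : ∀ n, Measurable (f n) := fun n =>
    Measurable.ite ((measurableSet_lt measurable_const hX).inter
      (measurableSet_le hX measurable_const)) (hX.div_const _) measurable_const
  have hf0 : ∀ n ω, 0 ≤ f n ω := by
    intro n ω
    simp only [hf]
    split_ifs with h
    · exact div_nonneg h.1.le (ha n).le
    · exact le_rfl
  have hf1 : ∀ n ω, f n ω ≤ 1 := by
    intro n ω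
    simp only [hf]
    split_ifs with h
    · exact (div_le_one (ha n)).2 h.2
    · exact zero_le_one
  have hfi : ∀ n, Integrable (f n) P := fun n =>
    Integrable.of_bound (hfm n).aestronglyMeasurable 1
      (ae_of_all _ fun ω => by rw [Real.norm_of_nonneg (hf0 n ω)]; exact hf1 n ω)
  have hlayer : ∀ n, ∫ ω, f n ω ∂P = ∫ t in Ioc (0 : ℝ) 1, P.real {ω | t < f n ω} := by
    intro n
    rw [(hfi n).integral_eq_integral_meas_lt (ae_of_all _ (hf0 n))]
    refine setIntegral_eq_of_subset_of_forall_sdiff_eq_zero measurableSet_Ioi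
      (fun t ht => ht.1) fun t ht => ?_
    have ht1 : 1 < t := by
      by_contra! h
      exact ht.2 ⟨ht.1, h⟩
    have : {ω | t < f n ω} = ∅ := by
      ext ω
      simpa using (hf1 n ω).trans ht1.le
    rw [this, measureReal_empty]
  have htail : ∀ n t, 0 < t → t ≤ 1 →
      P.real {ω | t < f n ω} = P.real {ω | t * a n < X ω} - P.real {ω | a n < X ω} := by
    intro n t ht ht1
    have hta : t * a n ≤ a n := mul_le_of_le_one_left (ha n).le ht1
    have hsub : {ω | a n < X ω} ⊆ {ω | t * a n < X ω} := fun ω hω => lt_of_le_of_lt hta hω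
    rw [← measureReal_sdiff hsub (measurableSet_lt measurable_const hX)]
    congr 1
    ext ω
    simp only [hf, mem_ofPred_eq, Set.mem_sdiff, not_lt]
    have hta0 : 0 < t * a n := mul_pos ht (ha n)
    split_ifs with h
    · rw [lt_div_iff₀ (ha n)]
      exact ⟨fun h' => ⟨h', h.2⟩, fun h' => h'.1⟩
    · exact ⟨fun h' => absurd h' ht.le.not_gt, fun h' => absurd ⟨hta0.trans h'.1, h'.2⟩ h⟩
  have hlim1 : ∀ t, 0 < t →
      Tendsto (fun n : ℕ => (n : ℝ) * P.real {ω | t * a n < X ω}) atTop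
        (nhds (p * t ^ (-α))) := by
    intro t ht
    have hta : Tendsto (fun n => t * a n) atTop atTop := hatop.const_mul_atTop ht
    have h := (han.mul ((hrv t ht).comp hatop)).mul (hbalp.comp hta)
    rw [one_mul, mul_comm] at h
    refine h.congr fun n => ?_
    have h1 : P.real {ω | a n < |X ω|} ≠ 0 := (hpos _ (ha n)).ne'
    have h2 : P.real {ω | t * a n < |X ω|} ≠ 0 := (hpos _ (mul_pos ht (ha n))).ne'
    simp only [Function.comp_apply]
    rw [mul_assoc, div_mul_div_comm]
    generalize P.real {ω | t * a n < |X ω|} = y at *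
    field_simp
  have hlim : ∀ t, 0 < t → t ≤ 1 →
      Tendsto (fun n : ℕ => (n : ℝ) * P.real {ω | t < f n ω}) atTop
        (nhds (p * t ^ (-α) - p)) := by
    intro t ht ht1
    have h := (hlim1 t ht).sub (hlim1 1 one_pos)
    simp only [Real.one_rpow, mul_one, one_mul] at h
    refine h.congr fun n => ?_
    rw [htail n t ht ht1]
    ring
  have hbound : ∀ᶠ n : ℕ in atTop, ∀ t, 0 < t → t ≤ 1 →
      (n : ℝ) * P.real {ω | t < f n ω} ≤ 2 * C * t ^ (-β) := by
    filter_upwards [han.eventually_lt_const one_lt_two,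
      hatop.eventually_ge_atTop (max x₀ 1)] with n hn hna t ht ht1
    have hle : P.real {ω | t < f n ω} ≤ T (t * a n) := by
      rw [htail n t ht ht1]
      refine (sub_le_self _ measureReal_nonneg).trans ?_
      exact measureReal_mono fun ω hω => lt_of_lt_of_le (mem_ofPred.1 hω) (le_abs_self (X ω))
    have htβ : 0 ≤ C * t ^ (-β) := by positivity
    calc (n : ℝ) * P.real {ω | t < f n ω} ≤ n * (C * t ^ (-β) * T (a n)) := by
          gcongr
          exact hle.trans (hC _ hna t ht ht1)
      _ = (C * t ^ (-β)) * (n * T (a n)) := by ring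
      _ ≤ (C * t ^ (-β)) * 2 := mul_le_mul_of_nonneg_left hn.le htβ
      _ = 2 * C * t ^ (-β) := by ring
  have hint : ∀ γ : ℝ, γ < 1 → IntegrableOn (fun t : ℝ => t ^ (-γ)) (Ioc 0 1) := by
    intro γ hγ
    exact (intervalIntegrable_iff_integrableOn_Ioc_of_le zero_le_one).1
      (intervalIntegral.intervalIntegrable_rpow' (by linarith))
  have hvalue : ∫ t in Ioc (0 : ℝ) 1, (p * t ^ (-α) - p) = p * (α / (1 - α)) := by
    rw [integral_sub ((hint α hα1).const_mul p) (integrable_const _), integral_const_mul,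
      ← intervalIntegral.integral_of_le zero_le_one, integral_rpow (Or.inl (by linarith))]
    have h1 : 1 - α ≠ 0 := by linarith
    have h2 : -α + 1 ≠ 0 := by linarith
    rw [Real.zero_rpow h2]
    simp
    field_simp
    ring
  rw [← hvalue]
  have hDCT := tendsto_integral_filter_of_dominated_convergence
    (μ := volume.restrict (Ioc (0 : ℝ) 1)) (l := atTop)
    (F := fun (n : ℕ) t => (n : ℝ) * P.real {ω | t < f n ω})
    (f := fun t => p * t ^ (-α) - p) (fun t => 2 * C * t ^ (-β))
    (Eventually.of_forall fun n => by
      have hanti : Antitone fun t => P.real {ω | t < f n ω} :=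
        fun s t hst => measureReal_mono fun ω hω => lt_of_le_of_lt hst hω
      exact (hanti.measurable.const_mul _).aestronglyMeasurable)
    (by
      filter_upwards [hbound] with n hn
      refine (ae_restrict_iff' measurableSet_Ioc).2 (ae_of_all _ fun t ht => ?_)
      rw [Real.norm_of_nonneg (by positivity)]
      exact hn t ht.1 ht.2)
    ((hint β hβ1).const_mul _)
    ((ae_restrict_iff' measurableSet_Ioc).2 (ae_of_all _ fun t ht => hlim t ht.1 ht.2))
  refine hDCT.congr fun n => ?_
  rw [integral_const_mul, hlayer n]

/-- if `X₁` is regularly varying with index `α ∈ (0,1)` and tail balance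
parameters `p`, `q`, and `n P(|X₁|>aₙ) → 1`, then
`n E[(X₁/aₙ) 1{|X₁| ≤ aₙ}] → (p−q) α/(1−α)`. -/
theorem truncated_mean_limit
    {Ω : Type*} [MeasurableSpace Ω] (P : Measure Ω) [IsProbabilityMeasure P]
    (X : Ω → ℝ) (hX : Measurable X)
    (α p q : ℝ) (hα : 0 < α) (hα1 : α < 1)
    (hp : 0 ≤ p) (hq : 0 ≤ q) (hpq : p + q = 1)
    -- regular variation of |X| with index α
    (hpos : ∀ x : ℝ, 0 < x → 0 < P {ω | x < |X ω|})
    (hrv : ∀ u : ℝ, 0 < u →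
      Tendsto (fun x : ℝ =>
          (P {ω | u * x < |X ω|}).toReal / (P {ω | x < |X ω|}).toReal)
        atTop (nhds (u ^ (-α))))
    -- tail balance
    (hbalp : Tendsto (fun x : ℝ =>
        (P {ω | x < X ω}).toReal / (P {ω | x < |X ω|}).toReal) atTop (nhds p))
    (hbalq : Tendsto (fun x : ℝ =>
        (P {ω | X ω < -x}).toReal / (P {ω | x < |X ω|}).toReal) atTop (nhds q))
    -- the normalizing sequence
    (a : ℕ → ℝ) (ha : ∀ n, 0 < a n)
    (han : Tendsto (fun n : ℕ => (n : ℝ) * (P {ω | a n < |X ω|}).toReal)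
      atTop (nhds 1)) :
    Tendsto (fun n : ℕ =>
        (n : ℝ) * ∫ ω, (if |X ω| ≤ a n then X ω / a n else 0) ∂P)
      atTop (nhds ((p - q) * (α / (1 - α)))) := by
  have hpos' : ∀ x : ℝ, 0 < x → 0 < P.real {ω | x < |X ω|} := fun x hx =>
    ENNReal.toReal_pos (hpos x hx).ne' (measure_ne_top _ _)
  have h1 := tendsto_truncated_mean_pos P X hX α p hα hα1 hpos' hrv hbalp a ha han
  have h2 := tendsto_truncated_mean_pos P (fun ω => -X ω) hX.neg α q hα hα1
    (by simpa only [abs_neg] using hpos')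
    (by simpa only [abs_neg, measureReal_def] using hrv)
    (by simpa only [abs_neg, lt_neg, measureReal_def] using hbalq)
    a ha (by simpa only [abs_neg, measureReal_def] using han)
  have h := h1.sub h2
  rw [← sub_mul] at h
  have hint : ∀ (Y : Ω → ℝ), Measurable Y → ∀ n,
      Integrable (fun ω => if 0 < Y ω ∧ Y ω ≤ a n then Y ω / a n else 0) P := by
    intro Y hY n
    refine Integrable.of_bound (Measurable.ite ((measurableSet_lt measurable_const hY).inter
      (measurableSet_le hY measurable_const)) (hY.div_const _)
      measurable_const).aestronglyMeasurable 1 (ae_of_all _ fun ω => ?_)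
    split_ifs with h
    · rw [Real.norm_of_nonneg (div_nonneg h.1.le (ha n).le)]
      exact (div_le_one (ha n)).2 h.2
    · simp
  refine h.congr fun n => ?_
  rw [← mul_sub, ← integral_sub (hint X hX n) (hint (fun ω => -X ω) hX.neg n)]
  congr 2
  ext ω
  have han0 := ha n
  rcases lt_trichotomy (X ω) 0 with hx | hx | hx
  · simp [abs_of_neg hx, hx, hx.not_gt, neg_div]
    split_ifs <;> simp
  · simp [hx]
  · simp [abs_of_pos hx, hx, hx.not_gt]
end

section
/- Let α>0 and let (Θ_i)_{i∈ℤ} be a sequence of real random variables with E[ ( Σ_{i≥0} |Θ_i| )^α ] < ∞. Then lim_{u↓0} ∫_u^∞ P( Σ_{i≥0} r Θ_i 1{ r|Θ_i| > u } > 1, sup_{i≤−1} r|Θ_i| ≤ u ) α r^{−α−1} dr = E[ ( max( Σ_{i≥0} Θ_i, 0 ) )^α · 1{ Θ_i = 0 for all i ≤ −1 } ], and the analogous statement with the event { Σ_{i≥0} r Θ_i 1{r|Θ_i|>u} < −1 } has limit E[ ( max( −Σ_{i≥0} Θ_i, 0 ) )^α · 1{ Θ_i = 0 for all i ≤ −1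 } ]. -/
open MeasureTheory Filter Set

section LevyMeasure

variable {Ω : Type*}

/-- Pairs `(ω, r)` with `r > u` at which the `u`-truncated series exceeds `1` while all terms of
negative index stay below `u`. -/
def truncatedExceedance (Θ : ℤ → Ω → ℝ) (u : ℝ) : Set (Ω × ℝ) :=
  {p | u < p.2 ∧
    1 < ∑' i : ℕ, (if u < p.2 * |Θ (i : ℤ) p.1| then p.2 * Θ (i : ℤ) p.1 else 0) ∧
    ∀ i : ℤ, i ≤ -1 → p.2 * |Θ i p.1| ≤ u}

/-- Pairs `(ω, r)` at which the full series scaled by `r` exceeds `1` while all terms of negative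
index vanish. -/
def fullExceedance (Θ : ℤ → Ω → ℝ) : Set (Ω × ℝ) :=
  {p | 1 < p.2 * ∑' i : ℕ, Θ (i : ℤ) p.1 ∧ ∀ i : ℤ, i ≤ -1 → Θ i p.1 = 0}

lemma tendsto_tsum_truncated {a : ℕ → ℝ} (ha : Summable fun i => |a i|) :
    Tendsto (fun u : ℝ => ∑' i, (if u < |a i| then a i else 0)) (nhdsWithin 0 (Ioi 0))
      (nhds (∑' i, a i)) := by
  refine tendsto_tsum_of_dominated_convergence ha (fun i => ?_) (.of_forall fun u i => ?_)
  · refine tendsto_const_nhds.congr' ?_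
    rcases eq_or_ne (a i) 0 with h | h
    · simp [h]
    · filter_upwards [mem_nhdsWithin_of_mem_nhds (Iio_mem_nhds (abs_pos.mpr h))] with u hu
      rw [if_pos (mem_Iio.mp hu)]
  · split_ifs <;> simp

lemma tsum_truncated_le {a : ℕ → ℝ} (ha : Summable fun i => |a i|) (u : ℝ) :
    ∑' i, (if u < |a i| then a i else 0) ≤ ∑' i, |a i| := by
  have h : ∀ i, |if u < |a i| then a i else 0| ≤ |a i| := fun i => by split_ifs <;> simp
  exact Summable.tsum_le_tsum (fun i => (le_abs_self _).trans (h i))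
    (Summable.of_norm_bounded ha h) ha

lemma eventually_mem_truncatedExceedance_iff {Θ : ℤ → Ω → ℝ} {ω : Ω} {r : ℝ} (hr : 0 < r)
    (hs : Summable fun i : ℕ => |Θ (i : ℤ) ω|) (hne : r * ∑' i : ℕ, Θ (i : ℤ) ω ≠ 1) :
    ∀ᶠ u in nhdsWithin (0 : ℝ) (Ioi 0),
      ((ω, r) ∈ truncatedExceedance Θ u ↔ (ω, r) ∈ fullExceedance Θ) := by
  have habs : ∀ i : ℤ, |r * Θ i ω| = r * |Θ i ω| := fun i => by rw [abs_mul, abs_of_pos hr]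
  have hlim := tendsto_tsum_truncated (a := fun i : ℕ => r * Θ (i : ℤ) ω)
    (by simpa only [habs] using hs.mul_left r)
  simp only [habs, tsum_mul_left] at hlim
  by_cases hpast : ∀ i : ℤ, i ≤ -1 → Θ i ω = 0
  · rcases lt_or_gt_of_ne hne with h | h
    · filter_upwards [hlim.eventually_lt_const h] with u hu
      simp [truncatedExceedance, fullExceedance, hu.not_gt, h.not_gt]
    · filter_upwards [hlim.eventually_const_lt h, self_mem_nhdsWithin,
        mem_nhdsWithin_of_mem_nhds (Iio_mem_nhds hr)] with u hu hu0 hur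
      refine iff_of_true ⟨hur, hu, fun i hi => ?_⟩ ⟨h, hpast⟩
      simpa [hpast i hi] using (mem_Ioi.mp hu0).le
  · have hpast' := hpast
    push Not at hpast'
    obtain ⟨i, hi, hi0⟩ := hpast'
    filter_upwards [mem_nhdsWithin_of_mem_nhds
      (Iio_mem_nhds (mul_pos hr (abs_pos.mpr hi0)))] with u hu
    exact iff_of_false (fun h => (h.2.2 i hi).not_gt hu) (fun h => hpast h.2)

lemma integrableOn_and_integral_indicator_rpow {α : ℝ} (hα : 0 < α) (s : ℝ) :
    IntegrableOn ({r : ℝ | 1 < r * s}.indicator fun r => α * r ^ (-α - 1)) (Ioi 0) ∧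
    ∫ r in Ioi 0, {r : ℝ | 1 < r * s}.indicator (fun r => α * r ^ (-α - 1)) r =
      (max s 0) ^ α := by
  have hm : MeasurableSet {r : ℝ | 1 < r * s} := measurableSet_lt (by fun_prop) (by fun_prop)
  rw [IntegrableOn, integrable_indicator_iff hm, IntegrableOn, Measure.restrict_restrict hm,
    integral_indicator hm, Measure.restrict_restrict hm]
  rcases le_or_gt s 0 with hs | hs
  · have hempty : {r : ℝ | 1 < r * s} ∩ Ioi 0 = ∅ := by
      refine eq_empty_of_forall_notMem fun r ⟨h1, h2⟩ => ?_
      have h1 : 1 < r * s := h1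
      have := mul_nonpos_of_nonneg_of_nonpos (mem_Ioi.mp h2).le hs
      linarith
    simp [hempty, hs, Real.zero_rpow hα.ne']
  · have hset : {r : ℝ | 1 < r * s} ∩ Ioi 0 = Ioi s⁻¹ := by
      ext r
      have h : s⁻¹ < r ↔ 1 < r * s := by rw [inv_lt_iff_one_lt_mul₀ hs]
      simp only [mem_inter_iff, mem_ofPred_eq, mem_Ioi, h, and_iff_left_iff_imp]
      exact fun h1 => (inv_pos.mpr hs).trans (h.mpr h1)
    have hs' := inv_pos.mpr hs
    have hlt : -α - 1 < -1 := by linarith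
    rw [hset]
    refine ⟨(integrableOn_Ioi_rpow_of_lt hlt hs').const_mul α, ?_⟩
    rw [integral_const_mul, integral_Ioi_rpow_of_lt hlt hs', max_eq_left hs.le, sub_add_cancel,
      Real.inv_rpow hs.le, Real.rpow_neg hs.le, inv_inv]
    field_simp

variable [MeasurableSpace Ω] {Θ : ℤ → Ω → ℝ}

lemma measurableSet_truncatedExceedance (hΘ : ∀ i, Measurable (Θ i)) (u : ℝ) :
    MeasurableSet (truncatedExceedance Θ u) := by
  have hm : ∀ i : ℤ, Measurable fun p : Ω × ℝ => p.2 * |Θ i p.1| := fun i =>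
    measurable_snd.mul (((hΘ i).comp measurable_fst).abs)
  simp only [truncatedExceedance, ofPred_and]
  refine (measurableSet_lt measurable_const measurable_snd).inter
    ((measurableSet_lt measurable_const (Measurable.tsum fun i => ?_)).inter ?_)
  · exact Measurable.ite (measurableSet_lt measurable_const (hm i))
      (measurable_snd.mul ((hΘ i).comp measurable_fst)) measurable_const
  · simp only [ofPred_forall]
    exact .iInter fun i => .iInter fun _ => measurableSet_le (hm i) measurable_const

lemma measurableSet_past_eq_zero (hΘ : ∀ i, Measurable (Θ i)) :
    MeasurableSet {ω | ∀ i : ℤ, i ≤ -1 → Θ i ω = 0} := by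
  simp only [ofPred_forall]
  exact .iInter fun i => .iInter fun _ => hΘ i (measurableSet_singleton 0)

lemma measurableSet_fullExceedance (hΘ : ∀ i, Measurable (Θ i)) :
    MeasurableSet (fullExceedance Θ) :=
  (measurableSet_lt measurable_const (measurable_snd.mul
    ((Measurable.tsum fun i : ℕ => hΘ i).comp measurable_fst))).inter
    (measurable_fst (measurableSet_past_eq_zero hΘ))

lemma tendsto_exceedance_integral (P : Measure Ω) [IsProbabilityMeasure P]
    {α : ℝ} (hα : 0 < α) (hΘ : ∀ i, Measurable (Θ i))
    (hmom : (∫⁻ ω, (∑' i : ℕ, ENNReal.ofReal |Θ (i : ℤ) ω|) ^ α ∂P) < ⊤) :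
    Tendsto (fun u : ℝ => ∫ r in Set.Ioi u,
        (P {ω |
          1 < ∑' i : ℕ, (if u < r * |Θ (i : ℤ) ω| then r * Θ (i : ℤ) ω else 0)
            ∧ ∀ i : ℤ, i ≤ -1 → r * |Θ i ω| ≤ u}).toReal * (α * r ^ (-α - 1)))
      (nhdsWithin 0 (Set.Ioi 0))
      (nhds (∫ ω, Set.indicator {ω | ∀ i : ℤ, i ≤ -1 → Θ i ω = 0}
        (fun ω => (max (∑' i : ℕ, Θ (i : ℤ) ω) 0) ^ α) ω ∂P)) := by
  set ν : Measure ℝ := volume.restrict (Ioi 0)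
  set w : ℝ → ℝ := fun r => α * r ^ (-α - 1) with hw
  have hwm : Measurable fun p : Ω × ℝ => w p.2 := by fun_prop
  set T : Ω → ℝ := fun ω => ∑' i : ℕ, |Θ (i : ℤ) ω| with hT
  have hTm : Measurable T := Measurable.tsum fun i => (hΘ i).abs
  have hEm : Measurable fun ω => (∑' i : ℕ, ENNReal.ofReal |Θ (i : ℤ) ω|) ^ α :=
    (Measurable.tsum fun i : ℕ => (hΘ i).abs.ennreal_ofReal).pow_const α
  have hsum : ∀ᵐ ω ∂P, Summable fun i : ℕ => |Θ (i : ℤ) ω| := by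
    filter_upwards [ae_lt_top hEm hmom.ne] with ω hω
    have h : ∑' i : ℕ, ENNReal.ofReal |Θ (i : ℤ) ω| ≠ ⊤ :=
      ((ENNReal.rpow_lt_top_iff_of_pos hα).mp hω).ne
    simpa using ENNReal.summable_toReal h
  have hTint : Integrable (fun ω => T ω ^ α) P := by
    refine (integrable_toReal_of_lintegral_ne_top hEm.aemeasurable hmom.ne).congr
      (.of_forall fun ω => ?_)
    simp only [← ENNReal.toReal_rpow, ENNReal.tsum_toReal_eq fun i => ENNReal.ofReal_ne_top,
      ENNReal.toReal_ofReal (abs_nonneg _), hT]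
  have hsum' : ∀ᵐ p ∂P.prod ν, Summable fun i : ℕ => |Θ (i : ℤ) p.1| :=
    Measure.quasiMeasurePreserving_fst.ae hsum
  have hpos : ∀ᵐ p ∂P.prod ν, 0 < p.2 :=
    Measure.quasiMeasurePreserving_snd.ae (ae_restrict_mem measurableSet_Ioi)
  have hSm : Measurable fun ω => ∑' i : ℕ, Θ (i : ℤ) ω := Measurable.tsum fun i => hΘ i
  have hne : ∀ᵐ p ∂P.prod ν, p.2 * ∑' i : ℕ, Θ (i : ℤ) p.1 ≠ 1 := by
    refine (Measure.ae_prod_iff_ae_ae ?_).mpr (.of_forall fun ω => ?_)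
    · exact (measurableSet_eq_fun (measurable_snd.mul (hSm.comp measurable_fst))
        measurable_const).compl
    · have : {(∑' i : ℕ, Θ (i : ℤ) ω)⁻¹}ᶜ ∈ ae ν :=
        compl_mem_ae_iff.mpr (measure_singleton _)
      filter_upwards [this] with r hr h
      exact hr (eq_inv_of_mul_eq_one_left h)
  have hbm : MeasurableSet {p : Ω × ℝ | 1 < p.2 * T p.1} :=
    measurableSet_lt measurable_const (measurable_snd.mul (hTm.comp measurable_fst))
  have hbound : Integrable ({p : Ω × ℝ | 1 < p.2 * T p.1}.indicator fun p => w p.2)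
      (P.prod ν) := by
    rw [integrable_prod_iff (hwm.indicator hbm).aestronglyMeasurable]
    refine ⟨.of_forall fun ω => (integrableOn_and_integral_indicator_rpow hα (T ω)).1,
      hTint.congr (.of_forall fun ω => ?_)⟩
    have h := (integrableOn_and_integral_indicator_rpow hα (T ω)).2
    rw [max_eq_left (show 0 ≤ T ω from tsum_nonneg fun i => abs_nonneg _)] at h
    refine h.symm.trans ?_
    refine setIntegral_congr_fun measurableSet_Ioi fun r hr => ?_
    have : 0 ≤ w r := mul_nonneg hα.le (Real.rpow_nonneg (mem_Ioi.mp hr).le _)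
    exact (Real.norm_of_nonneg (indicator_apply_nonneg fun _ => this)).symm
  have hdom : ∀ E : Set (Ω × ℝ), MeasurableSet E →
      (∀ p : Ω × ℝ, 0 < p.2 → (Summable fun i : ℕ => |Θ (i : ℤ) p.1|) → p ∈ E →
        1 < p.2 * T p.1) →
      (∀ᵐ p ∂P.prod ν, ‖E.indicator (fun p => w p.2) p‖ ≤
        {p : Ω × ℝ | 1 < p.2 * T p.1}.indicator (fun p => w p.2) p) ∧
      Integrable (E.indicator fun p => w p.2) (P.prod ν) := by
    intro E hE hsub
    have hle : ∀ᵐ p ∂P.prod ν, ‖E.indicator (fun p => w p.2) p‖ ≤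
        {p : Ω × ℝ | 1 < p.2 * T p.1}.indicator (fun p => w p.2) p := by
      filter_upwards [hsum', hpos] with p hs hp
      have hw0 : 0 ≤ w p.2 := mul_nonneg hα.le (Real.rpow_nonneg hp.le _)
      by_cases hpE : p ∈ E
      · rw [indicator_of_mem hpE, indicator_of_mem (by exact hsub p hp hs hpE),
          Real.norm_of_nonneg hw0]
      · rw [indicator_of_notMem hpE, norm_zero]
        exact indicator_apply_nonneg fun _ => hw0
    exact ⟨hle, hbound.mono' (hwm.indicator hE).aestronglyMeasurable hle⟩
  have htrunc := fun u => hdom _ (measurableSet_truncatedExceedance hΘ u) fun p hp hs hpE => by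
    have habs : ∀ i : ℤ, |p.2 * Θ i p.1| = p.2 * |Θ i p.1| := fun i => by
      rw [abs_mul, abs_of_pos hp]
    have h := tsum_truncated_le (a := fun i : ℕ => p.2 * Θ (i : ℤ) p.1)
      (by simpa only [habs] using hs.mul_left p.2) u
    simp only [habs, tsum_mul_left] at h
    exact hpE.2.1.trans_le h
  have hfull := (hdom _ (measurableSet_fullExceedance hΘ) fun p hp hs hpE =>
    hpE.1.trans_le (mul_le_mul_of_nonneg_left
      (Summable.tsum_le_tsum (fun i => le_abs_self _) hs.of_abs hs) hp.le)).2
  have key := tendsto_integral_filter_of_dominated_convergence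
    (l := nhdsWithin (0 : ℝ) (Ioi 0))
    (F := fun u => (truncatedExceedance Θ u).indicator fun p => w p.2)
    (f := (fullExceedance Θ).indicator fun p => w p.2) _
    (.of_forall fun u =>
      (hwm.indicator (measurableSet_truncatedExceedance hΘ u)).aestronglyMeasurable)
    (.of_forall fun u => (htrunc u).1) hbound (by
      filter_upwards [hsum', hpos, hne] with p hs hp hp1
      refine tendsto_const_nhds.congr' ?_
      filter_upwards [eventually_mem_truncatedExceedance_iff hp hs hp1] with u hu
      exact indicator_const_eq_indicator_const hu.symm)
  have hlim : ∫ p, (fullExceedance Θ).indicator (fun p => w p.2) p ∂P.prod ν =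
      ∫ ω, Set.indicator {ω | ∀ i : ℤ, i ≤ -1 → Θ i ω = 0}
        (fun ω => (max (∑' i : ℕ, Θ (i : ℤ) ω) 0) ^ α) ω ∂P := by
    rw [integral_prod _ hfull]
    congr 1 with ω
    by_cases h : ∀ i : ℤ, i ≤ -1 → Θ i ω = 0
    · rw [indicator_of_mem (by exact h),
        ← (integrableOn_and_integral_indicator_rpow hα (∑' i : ℕ, Θ (i : ℤ) ω)).2]
      congr 1 with r
      exact indicator_const_eq_indicator_const (and_iff_left h)
    · rw [indicator_of_notMem (by exact h), ← integral_zero ℝ ℝ (μ := ν)]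
      congr 1 with r
      exact indicator_of_notMem (fun hr => h hr.2) _
  rw [← hlim]
  refine key.congr' ?_
  filter_upwards [self_mem_nhdsWithin] with u hu
  have hEu := measurableSet_truncatedExceedance hΘ u
  rw [integral_prod_symm _ (htrunc u).2]
  have hIoi : Ioi u = Ioi u ∩ Ioi 0 := (inter_eq_left.mpr (Ioi_subset_Ioi (mem_Ioi.mp hu).le)).symm
  rw [hIoi, ← Measure.restrict_restrict measurableSet_Ioi,
    ← integral_indicator (measurableSet_Ioi (a := u))]
  refine congrArg (fun f : ℝ → ℝ => ∫ r, f r ∂ν) (funext fun r => ?_)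
  have hslice : ∀ ω, (truncatedExceedance Θ u).indicator (fun p => w p.2) (ω, r) =
      ((fun ω => (ω, r)) ⁻¹' truncatedExceedance Θ u).indicator (fun _ => w r) ω := fun _ => rfl
  simp only [hslice]
  rw [integral_indicator_const _ (measurable_prodMk_right hEu), smul_eq_mul]
  by_cases hr : u < r
  · rw [indicator_of_mem (by exact hr)]
    simp [truncatedExceedance, hr, Measure.real, hw]
  · rw [indicator_of_notMem (by exact hr)]
    simp [truncatedExceedance, hr]

end LevyMeasure

/-- under the moment condition `E[(Σ_{i≥0}|Θ_i|)^α] < ∞`,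
`lim_{u↓0} ∫_u^∞ P(Σ_{i≥0} rΘ_i 1{r|Θ_i|>u} > 1, sup_{i≤−1} r|Θ_i| ≤ u) α r^{−α−1} dr
  = E[(max(Σ_{i≥0}Θ_i,0))^α 1{∀ i≤−1 : Θ_i = 0}]`,
and analogously for the event `{... < −1}` with limit
`E[(max(−Σ_{i≥0}Θ_i,0))^α 1{∀ i≤−1 : Θ_i = 0}]`. -/
theorem levy_measure_constants_limit
    {Ω : Type*} [MeasurableSpace Ω] (P : Measure Ω) [IsProbabilityMeasure P]
    (α : ℝ) (hα : 0 < α)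
    (Θ : ℤ → Ω → ℝ) (hΘ : ∀ i, Measurable (Θ i))
    -- E[(Σ_{i≥0}|Θ_i|)^α] < ∞, the sum taken in [0,∞]
    (hmom : (∫⁻ ω, (∑' i : ℕ, ENNReal.ofReal |Θ (i : ℤ) ω|) ^ α ∂P) < ⊤) :
    Tendsto (fun u : ℝ => ∫ r in Set.Ioi u,
        (P {ω |
          1 < ∑' i : ℕ, (if u < r * |Θ (i : ℤ) ω| then r * Θ (i : ℤ) ω else 0)
            ∧ ∀ i : ℤ, i ≤ -1 → r * |Θ i ω| ≤ u}).toReal * (α * r ^ (-α - 1)))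
      (nhdsWithin 0 (Set.Ioi 0))
      (nhds (∫ ω, Set.indicator {ω | ∀ i : ℤ, i ≤ -1 → Θ i ω = 0}
        (fun ω => (max (∑' i : ℕ, Θ (i : ℤ) ω) 0) ^ α) ω ∂P))
    ∧ Tendsto (fun u : ℝ => ∫ r in Set.Ioi u,
        (P {ω |
          (∑' i : ℕ, (if u < r * |Θ (i : ℤ) ω| then r * Θ (i : ℤ) ω else 0)) < -1
            ∧ ∀ i : ℤ, i ≤ -1 → r * |Θ i ω| ≤ u}).toReal * (α * r ^ (-α - 1)))
      (nhdsWithin 0 (Set.Ioi 0))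
      (nhds (∫ ω, Set.indicator {ω | ∀ i : ℤ, i ≤ -1 → Θ i ω = 0}
        (fun ω => (max (-∑' i : ℕ, Θ (i : ℤ) ω) 0) ^ α) ω ∂P)) := by
  refine ⟨tendsto_exceedance_integral P hα hΘ hmom, ?_⟩
  have h := tendsto_exceedance_integral (Θ := fun i ω => -Θ i ω) P hα (fun i => (hΘ i).neg)
    (by simpa only [abs_neg] using hmom)
  have hite : ∀ (c : Prop) [Decidable c] (x : ℝ),
      (if c then -x else 0) = -(if c then x else 0) := fun c _ x => by split_ifs <;> simp
  simpa only [abs_neg, mul_neg, hite, tsum_neg, lt_neg (a := (1 : ℝ)), neg_eq_zero] using h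
end
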